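/- Theorem 2 (theory-driven partitioning): suppose BC₁(F) ∪ Cl rules out P(F). Let F' := F ∧ ⋀Cl, and suppose BC₂(F') ∪ Cl' rules out P(F'). Then Cl ∪ Cl' rules out P(F). -/

import Mathlib

/-- Theorem 2, theory-driven partitioning: if `BC₁(F) ∪ Cl` rules out
`P(F)` and, with `F' := F ∧ ⋀Cl`, `BC₂(F') ∪ Cl'` rules out `P(F')`, then
`Cl ∪ Cl'` rules out `P(F)`. -/
theorem stmt15 {α₁ α₂ : Type*} (F : (α₁ ⊕ α₂ → Bool) → Bool)
    (Sat₁ : (α₁ → Bool) → Prop) (Sat₂ : (α₂ → Bool) → Prop)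
    (Cl Cl' : Set ((α₁ ⊕ α₂ → Bool) → Bool))
    (h1 : ∀ ρ : α₁ ⊕ α₂ → Bool,
        (F ρ = true ∧ ¬ (Sat₁ (ρ ∘ Sum.inl) ∧ Sat₂ (ρ ∘ Sum.inr))) →
        (∃ η : α₁ ⊕ α₂ → Bool,
            (F η = true ∧ Sat₁ (η ∘ Sum.inl) ∧ Sat₂ (η ∘ Sum.inr)) ∧
            ρ ∘ Sum.inl = η ∘ Sum.inl) ∨
        (∃ C ∈ Cl, C ρ = false))
    (h2 : ∀ ρ : α₁ ⊕ α₂ → Bool,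
        ((F ρ = true ∧ ∀ C ∈ Cl, C ρ = true) ∧
          ¬ (Sat₁ (ρ ∘ Sum.inl) ∧ Sat₂ (ρ ∘ Sum.inr))) →
        (∃ η : α₁ ⊕ α₂ → Bool,
            ((F η = true ∧ ∀ C ∈ Cl, C η = true) ∧
              Sat₁ (η ∘ Sum.inl) ∧ Sat₂ (η ∘ Sum.inr)) ∧
            ρ ∘ Sum.inr = η ∘ Sum.inr) ∨
        (∃ C ∈ Cl', C ρ = false)) :
    ∀ ρ : α₁ ⊕ α₂ → Bool,
      (F ρ = true ∧ ¬ (Sat₁ (ρ ∘ Sum.inl) ∧ Sat₂ (ρ ∘ Sum.inr))) →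
      ∃ C ∈ Cl ∪ Cl', C ρ = false := by
  rintro ρ ⟨hF, hUnsat⟩
  by_cases hCl : ∃ C ∈ Cl, C ρ = false
  · obtain ⟨C, hC, hρ⟩ := hCl
    exact ⟨C, Or.inl hC, hρ⟩
  · have hTrue : ∀ C ∈ Cl, C ρ = true := fun C hC =>
      (Bool.eq_false_or_eq_true (C ρ)).resolve_right fun h => hCl ⟨C, hC, h⟩
    obtain ⟨η, ⟨-, hη₁, -⟩, hinl⟩ := (h1 ρ ⟨hF, hUnsat⟩).resolve_right hCl
    rcases h2 ρ ⟨⟨hF, hTrue⟩, hUnsat⟩ with ⟨η', ⟨-, -, hη₂⟩, hinr⟩ | ⟨C, hC, hρ⟩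
    · exact absurd ⟨hinl ▸ hη₁, hinr ▸ hη₂⟩ hUnsat
    · exact ⟨C, Or.inr hC, hρ⟩
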